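/- Let K ⊂ ℝ² be compact and connected with H¹(K) < ∞, and suppose K minimizes H¹ among all compact connected sets containing a given finite set S = {x₁,…,x_N} ⊂ ℝ². Let γ_K be a Lipschitz closed curve with image K, zero winding number off K, and length 2H¹(K). Then γ_K minimizes the length functional over the class of all Lipschitz closed curves β whose image contains S and which satisfy ω(β, x) = 0 for every x ∉ β(ℝ/ℤ). Conversely, if γ minimizes length in this class, then its image γ(ℝ/ℤ) is a compact connected set containing S minimizing H¹. -/

import Mathlib

open MeasureTheory Set

/-- Winding number of a closed curve (1-periodic map ℝ → ℂ) around a point. -/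
noncomputable def winding (γ : ℝ → ℂ) (x : ℂ) : ℂ :=
  (2 * Real.pi * Complex.I)⁻¹ * ∫ t in (0:ℝ)..1, deriv γ t / (γ t - x)

/-- Length of a closed Lipschitz curve. -/
noncomputable def curveLength (β : ℝ → ℂ) : ℝ := ∫ t in (0:ℝ)..1, ‖deriv β t‖

/-- The admissible class: Lipschitz closed curves whose image contains `S` and whose
winding number vanishes identically off the image. -/
def InClass (S : Set ℂ) (β : ℝ → ℂ) : Prop :=
  Function.Periodic β 1 ∧ (∃ L : NNReal, LipschitzWith L β) ∧
    S ⊆ Set.range β ∧ ∀ x ∉ Set.range β, winding β x = 0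

/-- One-dimensional Hausdorff measure on ℂ ≅ ℝ². -/
noncomputable def H1 : MeasureTheory.Measure ℂ := MeasureTheory.Measure.hausdorffMeasure 1

open Filter Topology

/-- `DeltaChain K G δ z L`: there is a finite chain of points of `K` from `z` to a point of `G`,
with steps of size at most `δ` and total length `L`. -/
inductive DeltaChain (K G : Set ℂ) (δ : ℝ) : ℂ → ℝ → Prop
  | base {z : ℂ} (hz : z ∈ K) (hG : z ∈ G) : DeltaChain K G δ z 0
  | step {z w : ℂ} {L : ℝ} (hz : z ∈ K) (hzw : dist z w ≤ δ) (h : DeltaChain K G δ w L) :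
      DeltaChain K G δ z (dist z w + L)

namespace DeltaChain

variable {K G : Set ℂ} {δ L : ℝ} {z w : ℂ}

lemma nonneg (h : DeltaChain K G δ z L) : 0 ≤ L := by
  induction h with
  | base => exact le_rfl
  | step _ _ _ ih => positivity

lemma exists_path (hδ : 0 ≤ δ) (h : DeltaChain K G δ z L) :
    ∃ f : ℝ → ℂ, f 0 = z ∧ f L ∈ G ∧ (∀ t, f t ∈ K) ∧ (∀ t, 0 ≤ t → dist z (f t) ≤ t) ∧
      ∀ s t, 0 ≤ s → s ≤ t → dist (f s) (f t) ≤ t - s + δ := by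
  induction h with
  | @base z hz hG =>
    refine ⟨fun _ => z, rfl, hG, fun _ => hz, fun t ht => by simpa using ht, fun s t hs hst => ?_⟩
    simp only [dist_self]
    linarith
  | @step z w L hz hzw h ih =>
    obtain ⟨f, hf0, hfL, hfK, hf1, hf2⟩ := ih
    rcases (dist_nonneg (x := z) (y := w)).eq_or_lt with h0 | h0
    · have : z = w := dist_eq_zero.1 h0.symm
      subst this
      refine ⟨f, hf0, by simpa using hfL, hfK, hf1, hf2⟩
    refine ⟨fun t => if t < dist z w then z else f (t - dist z w), by simp [h0], ?_, ?_, ?_, ?_⟩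
    · have := h.nonneg
      simpa [not_lt.2 this] using hfL
    · intro t
      dsimp only
      split_ifs
      exacts [hz, hfK _]
    · intro t ht
      dsimp only
      split_ifs with h1
      · simpa using ht
      · have := dist_triangle z w (f (t - dist z w))
        linarith [hf1 (t - dist z w) (by linarith)]
    · intro s t hs hst
      dsimp only
      split_ifs with h1 h2 h2
      · simp only [dist_self]; linarith
      · have := dist_triangle z w (f (t - dist z w))
        linarith [hf1 (t - dist z w) (by linarith)]
      · linarith
      · linarith [hf2 (s - dist z w) (t - dist z w) (by linarith) (by linarith)]

lemma exists_of_isPreconnected (hK : IsPreconnected K) (hKG : (K ∩ G).Nonempty) (hδ : 0 < δ)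
    (hz : z ∈ K) : ∃ L, DeltaChain K G δ z L := by
  by_contra hne
  obtain ⟨p, hpK, hpG⟩ := hKG
  let R : Set ℂ := {y | y ∈ K ∧ ∃ L, DeltaChain K G δ y L}
  have key := hK (⋃ y ∈ R, Metric.ball y δ) (⋃ y ∈ K \ R, Metric.ball y δ)
    (isOpen_biUnion fun _ _ => Metric.isOpen_ball) (isOpen_biUnion fun _ _ => Metric.isOpen_ball)
    (fun y hy => by
      by_cases hyR : y ∈ R
      · exact Or.inl (mem_biUnion hyR (Metric.mem_ball_self hδ))
      · exact Or.inr (mem_biUnion (⟨hy, hyR⟩ : y ∈ K \ R) (Metric.mem_ball_self hδ)))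
    ⟨p, hpK, mem_biUnion (⟨hpK, 0, .base hpK hpG⟩ : p ∈ R) (Metric.mem_ball_self hδ)⟩
    ⟨z, hz, mem_biUnion (⟨hz, fun h => hne h.2⟩ : z ∈ K \ R) (Metric.mem_ball_self hδ)⟩
  obtain ⟨y, hyK, hy1, hy2⟩ := key
  simp only [mem_iUnion, Metric.mem_ball] at hy1 hy2
  obtain ⟨a, ⟨_, La, ha⟩, hya⟩ := hy1
  obtain ⟨b, ⟨hbK, hbR⟩, hyb⟩ := hy2
  exact hbR ⟨hbK, _, .step hbK (by rw [dist_comm]; exact hyb.le) (.step hyK hya.le ha)⟩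

end DeltaChain

/-- Infimum of the lengths of `δ`-chains in `K` from `z` to `G`. -/
noncomputable def chainDist (K G : Set ℂ) (δ : ℝ) (z : ℂ) : ℝ := sInf {L | DeltaChain K G δ z L}

section chainDist

variable {K G : Set ℂ} {δ : ℝ} {z w : ℂ}

lemma bddBelow_deltaChain : BddBelow {L | DeltaChain K G δ z L} := ⟨0, fun _ h => h.nonneg⟩

lemma chainDist_nonneg : 0 ≤ chainDist K G δ z := Real.sInf_nonneg fun _ h => h.nonneg

lemma chainDist_eq_zero (hK : z ∈ K) (hG : z ∈ G) : chainDist K G δ z = 0 :=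
  le_antisymm (csInf_le bddBelow_deltaChain (.base hK hG)) chainDist_nonneg

lemma chainDist_le_add (hK : IsPreconnected K) (hKG : (K ∩ G).Nonempty) (hδ : 0 < δ)
    (hz : z ∈ K) (hw : w ∈ K) (hzw : dist z w ≤ δ) :
    chainDist K G δ z ≤ chainDist K G δ w + dist z w := by
  rw [← sub_le_iff_le_add]
  refine le_csInf (DeltaChain.exists_of_isPreconnected hK hKG hδ hw) fun L hL => ?_
  rw [sub_le_iff_le_add, add_comm]
  exact csInf_le bddBelow_deltaChain (DeltaChain.step hz hzw hL)

lemma lipschitzOnWith_chainDist (hK : IsPreconnected K) (hKG : (K ∩ G).Nonempty) (hδ : 0 < δ)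
    {s : Set ℂ} (hs : s ⊆ K) (hd : ∀ x ∈ s, ∀ y ∈ s, dist x y ≤ δ) :
    LipschitzOnWith 1 (chainDist K G δ) s :=
  LipschitzOnWith.of_le_add fun x hx y hy =>
    chainDist_le_add hK hKG hδ (hs hx) (hs hy) (hd x hx y hy)

lemma continuousOn_chainDist (hK : IsPreconnected K) (hKG : (K ∩ G).Nonempty) (hδ : 0 < δ) :
    ContinuousOn (chainDist K G δ) K := by
  intro x hx
  have h := lipschitzOnWith_chainDist hK hKG hδ (s := K ∩ Metric.ball x (δ / 2)) inter_subset_left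
    (fun a ha b hb => by
      have := dist_triangle_right a b x
      linarith [Metric.mem_ball.1 ha.2, Metric.mem_ball.1 hb.2])
  have hc := h.continuousOn x ⟨hx, Metric.mem_ball_self (by positivity)⟩
  exact (continuousWithinAt_inter (Metric.ball_mem_nhds x (by positivity))).1 hc

/-- A function that is `1`-Lipschitz at small scales does not increase `H1`. -/
lemma hausdorffMeasure_image_le_of_locally_lipschitz {f : ℂ → ℝ} {s : Set ℂ}
    (hs : MeasurableSet s) (hδ : 0 < δ)
    (hf : ∀ t ⊆ s, (∀ x ∈ t, ∀ y ∈ t, dist x y ≤ δ) → LipschitzOnWith 1 f t) :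
    Measure.hausdorffMeasure 1 (f '' s) ≤ H1 s := by
  let B : ℕ → Set ℂ := fun n => Metric.ball (TopologicalSpace.denseSeq ℂ n) (δ / 2)
  have hB : ⋃ n, B n = univ := by
    refine eq_univ_of_forall fun x => ?_
    obtain ⟨n, hn⟩ := (TopologicalSpace.denseRange_denseSeq ℂ).exists_dist_lt x (half_pos hδ)
    exact mem_iUnion.2 ⟨n, hn⟩
  let P : ℕ → Set ℂ := fun n => s ∩ disjointed B n
  have hP : ⋃ n, P n = s := by
    rw [← inter_iUnion, iUnion_disjointed, hB, inter_univ]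
  have hPm : ∀ n, MeasurableSet (P n) := fun n =>
    hs.inter (MeasurableSet.disjointed (fun n => Metric.isOpen_ball.measurableSet) n)
  have hPd : Pairwise (Function.onFun Disjoint P) := fun i j hij =>
    (disjoint_disjointed B hij).mono inter_subset_right inter_subset_right
  calc Measure.hausdorffMeasure 1 (f '' s)
      = Measure.hausdorffMeasure 1 (⋃ n, f '' P n) := by rw [← image_iUnion, hP]
    _ ≤ ∑' n, Measure.hausdorffMeasure 1 (f '' P n) := measure_iUnion_le _
    _ ≤ ∑' n, H1 (P n) := by
        refine ENNReal.tsum_le_tsum fun n => ?_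
        have := (hf (P n) inter_subset_left fun x hx y hy => by
          have h1 := Metric.mem_ball.1 (disjointed_subset B n hx.2)
          have h2 := Metric.mem_ball.1 (disjointed_subset B n hy.2)
          have := dist_triangle_right x y (TopologicalSpace.denseSeq ℂ n)
          linarith).hausdorffMeasure_image_le (d := 1) zero_le_one
        simpa [H1] using this
    _ = H1 s := by rw [← measure_iUnion hPd hPm, hP]

lemma ofReal_chainDist_le (hKc : IsClosed K) (hK : IsPreconnected K) (hG : IsClosed G)
    (hKG : (K ∩ G).Nonempty) (hδ : 0 < δ) (hz : z ∈ K) :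
    ENNReal.ofReal (chainDist K G δ z) ≤ H1 (K \ G) := by
  obtain ⟨p, hpK, hpG⟩ := hKG
  have hsub : Ioc 0 (chainDist K G δ z) ⊆ chainDist K G δ '' (K \ G) := by
    intro r hr
    have hIcc := (hK.image _ (continuousOn_chainDist hK ⟨p, hpK, hpG⟩ hδ)).Icc_subset
      (mem_image_of_mem _ hpK) (mem_image_of_mem _ hz)
    rw [chainDist_eq_zero hpK hpG] at hIcc
    obtain ⟨y, hy, rfl⟩ := hIcc ⟨hr.1.le, hr.2⟩
    exact ⟨y, ⟨hy, fun h => hr.1.ne' (chainDist_eq_zero hy h)⟩, rfl⟩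
  calc ENNReal.ofReal (chainDist K G δ z)
      = volume (Ioc 0 (chainDist K G δ z)) := by simp
    _ ≤ volume (chainDist K G δ '' (K \ G)) := measure_mono hsub
    _ = Measure.hausdorffMeasure 1 (chainDist K G δ '' (K \ G)) := by rw [hausdorffMeasure_real]
    _ ≤ H1 (K \ G) := hausdorffMeasure_image_le_of_locally_lipschitz
        (hKc.measurableSet.diff hG.measurableSet) hδ fun t ht hd =>
          lipschitzOnWith_chainDist hK ⟨p, hpK, hpG⟩ hδ (ht.trans sdiff_subset) hd

end chainDist

/-- `JoinedBy K G x L`: a `1`-Lipschitz path in `K` of duration `L` joins `x` to `G`. -/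
def JoinedBy (K G : Set ℂ) (x : ℂ) (L : ℝ) : Prop :=
  0 ≤ L ∧ ∃ c : ℝ → ℂ, LipschitzOnWith 1 c (Ici 0) ∧ (∀ t, 0 ≤ t → c t ∈ K) ∧ c 0 = x ∧ c L ∈ G

lemma JoinedBy.mono {K K' G : Set ℂ} {x : ℂ} {L : ℝ} (h : JoinedBy K G x L) (hK : K ⊆ K') :
    JoinedBy K' G x L := by
  obtain ⟨hL, c, hc, hcK, hc0, hcL⟩ := h
  exact ⟨hL, c, hc, fun t ht => hK (hcK t ht), hc0, hcL⟩

lemma exists_joinedBy {K G : Set ℂ} (hKc : IsCompact K) (hK : IsPreconnected K) (hG : IsClosed G)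
    (hKG : (K ∩ G).Nonempty) (hfin : H1 (K \ G) ≠ ⊤) {x : ℂ} (hx : x ∈ K) :
    ∃ L, JoinedBy K G x L ∧ ENNReal.ofReal L ≤ H1 (K \ G) := by
  set m := (H1 (K \ G)).toReal with hm
  have hδ : ∀ n : ℕ, (0 : ℝ) < 1 / ((n : ℝ) + 1) := fun n => Nat.one_div_pos_of_nat
  have hstep : ∀ n : ℕ, ∃ L f, 0 ≤ L ∧ L ≤ m + 1 / ((n : ℝ) + 1) ∧ (f : ℝ → ℂ) 0 = x ∧ f L ∈ G ∧
      (∀ t, f t ∈ K) ∧ ∀ s t, 0 ≤ s → s ≤ t → dist (f s) (f t) ≤ t - s + 1 / ((n : ℝ) + 1) := by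
    intro n
    have h1 := ofReal_chainDist_le hKc.isClosed hK hG hKG (hδ n) hx
    rw [ENNReal.ofReal_le_iff_le_toReal hfin] at h1
    obtain ⟨L, hL, hLlt⟩ := exists_lt_of_csInf_lt
      (DeltaChain.exists_of_isPreconnected hK hKG (hδ n) hx)
      (lt_add_of_pos_right (chainDist K G (1 / ((n : ℝ) + 1)) x) (hδ n))
    obtain ⟨f, h0, hfL, hfK, -, hf⟩ := DeltaChain.exists_path (hδ n).le hL
    exact ⟨L, f, hL.nonneg, by linarith, h0, hfL, hfK, hf⟩
  choose L f hL0 hLm hf0 hfL hfK hf using hstep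
  let U : Ultrafilter ℕ := hyperfilter ℕ
  have hU : (U : Filter ℕ) ≤ atTop := by
    rw [← Nat.cofinite_eq_atTop]; exact hyperfilter_le_cofinite
  have hlim : Tendsto (fun n : ℕ => 1 / ((n : ℝ) + 1)) U (𝓝 0) :=
    tendsto_one_div_add_atTop_nhds_zero_nat.mono_left hU
  have hc : ∀ t, ∃ p ∈ K, Tendsto (fun n => f n t) U (𝓝 p) := fun t =>
    hKc.ultrafilter_le_nhds (U.map fun n => f n t) 
      (le_principal_iff.2 (Filter.mem_map.2 (univ_mem' fun n => hfK n t)))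
  choose c hcK hct using hc
  obtain ⟨L', hL', hLt⟩ : ∃ p ∈ Icc 0 (m + 1), Tendsto L U (𝓝 p) :=
    isCompact_Icc.ultrafilter_le_nhds (U.map L) (by
      refine le_principal_iff.2 (Filter.mem_map.2 (univ_mem' fun n => ⟨hL0 n, (hLm n).trans ?_⟩))
      have : 1 / ((n : ℝ) + 1) ≤ 1 := by
        rw [div_le_one (by positivity)]; linarith [(n.cast_nonneg : (0:ℝ) ≤ n)]
      linarith)
  have hdist : ∀ n s t, 0 ≤ s → 0 ≤ t → dist (f n s) (f n t) ≤ |s - t| + 1 / ((n : ℝ) + 1) := by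
    intro n s t hs ht
    rcases le_total s t with h | h
    · rw [abs_sub_comm, abs_of_nonneg (sub_nonneg.2 h)]; exact hf n s t hs h
    · rw [abs_of_nonneg (sub_nonneg.2 h), dist_comm]; exact hf n t s ht h
  refine ⟨L', ⟨hL'.1, c, ?_, fun t _ => hcK t, ?_, ?_⟩, ?_⟩
  · refine LipschitzOnWith.of_dist_le_mul fun s hs t ht => ?_
    have h2 : Tendsto (fun n : ℕ => |s - t| + 1 / ((n : ℝ) + 1)) U (𝓝 (|s - t| + 0)) :=
      tendsto_const_nhds.add hlim
    have := le_of_tendsto_of_tendsto' ((hct s).dist (hct t)) h2 fun n => hdist n s t hs ht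
    simpa [Real.dist_eq] using this
  · refine tendsto_nhds_unique (hct 0) ?_
    simp [hf0]
  · have h2 : Tendsto (fun n : ℕ => |L n - L'| + 1 / ((n : ℝ) + 1)) U (𝓝 0) := by
      have := ((hLt.sub_const L').abs).add hlim
      simpa using this
    have h3 : Tendsto (fun n => dist (f n (L n)) (f n L')) U (𝓝 0) :=
      squeeze_zero (fun _ => dist_nonneg) (fun n => hdist n _ _ (hL0 n) hL'.1) h2
    have h4 : Tendsto (fun n => f n (L n)) U (𝓝 (c L')) :=
      (hct L').congr_dist (by simpa [dist_comm] using h3)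
    exact hG.mem_of_tendsto h4 (Eventually.of_forall hfL)
  · rw [ENNReal.ofReal_le_iff_le_toReal hfin]
    have := le_of_tendsto_of_tendsto' hLt (tendsto_const_nhds.add hlim) hLm
    simpa using this

lemma intervalIntegrable_deriv_div {β : ℝ → ℂ} {C : NNReal} (hβ : LipschitzWith C β) {a b : ℝ}
    (hab : a ≤ b) {x : ℂ} (hx : x ∉ β '' Icc a b) :
    IntervalIntegrable (fun t => deriv β t / (β t - x)) volume a b := by
  have h1 : IntervalIntegrable (deriv β) volume a b := by
    refine (intervalIntegrable_const (c := (C : ℝ))).mono_fun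
      (measurable_deriv β).aestronglyMeasurable (Eventually.of_forall fun t => ?_)
    simpa using norm_deriv_le_of_lipschitz hβ
  refine h1.mul_continuousOn (g := fun t => (β t - x)⁻¹) ?_
  rw [uIcc_of_le hab]
  refine ContinuousOn.inv₀ (hβ.continuous.continuousOn.sub continuousOn_const) fun t ht h => ?_
  exact hx ⟨t, ht, sub_eq_zero.1 h⟩

lemma integral_deriv_div_congr {f g : ℝ → ℂ} {a b : ℝ} (hab : a ≤ b) (h : EqOn f g (Ioo a b))
    (x : ℂ) : ∫ t in a..b, deriv f t / (f t - x) = ∫ t in a..b, deriv g t / (g t - x) := by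
  rw [intervalIntegral.integral_of_le hab, intervalIntegral.integral_of_le hab,
    integral_Ioc_eq_integral_Ioo, integral_Ioc_eq_integral_Ioo]
  refine setIntegral_congr_fun measurableSet_Ioo fun t ht => ?_
  have : f =ᶠ[𝓝 t] g := h.eventuallyEq_of_mem (Ioo_mem_nhds ht.1 ht.2)
  simp only [this.deriv_eq, h ht]

lemma LipschitzWith.ite_le {f g : ℝ → ℂ} {C : NNReal} (hf : LipschitzWith C f)
    (hg : LipschitzWith C g) {a : ℝ} (h : f a = g a) :
    LipschitzWith C fun t => if t ≤ a then f t else g t := by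
  have key : ∀ s t, s ≤ t →
      dist (if s ≤ a then f s else g s) (if t ≤ a then f t else g t) ≤ C * (t - s) := by
    intro s t hst
    have hd : ∀ u v : ℝ, u ≤ v → dist u v = v - u := fun u v huv => by
      rw [dist_comm, Real.dist_eq, abs_of_nonneg (sub_nonneg.2 huv)]
    split_ifs with h1 h2 h2
    · simpa [hd _ _ hst] using hf.dist_le_mul s t
    · have h3 := hf.dist_le_mul s a
      have h4 := hg.dist_le_mul a t
      rw [hd _ _ h1] at h3
      rw [hd _ _ (not_le.1 h2).le, ← h] at h4
      have := dist_triangle (f s) (f a) (g t)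
      linarith
    · exact absurd (hst.trans h2) h1
    · simpa [hd _ _ hst] using hg.dist_le_mul s t
  refine LipschitzWith.of_dist_le_mul fun s t => ?_
  rcases le_total s t with hst | hst
  · rw [dist_comm s t, Real.dist_eq, abs_of_nonneg (sub_nonneg.2 hst)]
    exact key s t hst
  · rw [Real.dist_eq, abs_of_nonneg (sub_nonneg.2 hst), dist_comm]
    exact key t s hst

/-- `β` restricted to `[0, ℓ]` is a closed curve whose winding number vanishes off its image. -/
structure IsNullLoop (β : ℝ → ℂ) (ℓ : ℝ) : Prop where
  nonneg : 0 ≤ ℓ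
  lipschitz : LipschitzWith 1 β
  closed : β 0 = β ℓ
  integral_eq_zero : ∀ x ∉ β '' Icc 0 ℓ, ∫ t in (0 : ℝ)..ℓ, deriv β t / (β t - x) = 0

/-- Running back and forth along a path does not contribute to the winding number. -/
lemma integral_comp_abs_eq_zero (c : ℝ → ℂ) (d L : ℝ) (x : ℂ) :
    ∫ t in (d - L)..(d + L), deriv (fun t => c |t - d|) t / (c |t - d| - x) = 0 := by
  set h : ℝ → ℂ := fun s => c |s| with hh
  have heven : (fun s => h (-s)) = h := by ext s; simp [hh]
  have hodd : ∀ s, deriv h (-s) = -deriv h s := fun s => by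
    have h1 := deriv_comp_neg h s
    rw [heven] at h1
    rw [h1, neg_neg]
  have h1 : ∀ t, deriv (fun t => c |t - d|) t = deriv h (t - d) := fun t =>
    deriv_comp_sub_const h d t
  simp_rw [h1]
  have h2 := intervalIntegral.integral_comp_sub_right (a := d - L) (b := d + L)
    (fun s => deriv h s / (h s - x)) d
  have h3 := intervalIntegral.integral_comp_neg (a := -L) (b := L)
    (fun s => deriv h s / (h s - x))
  have h4 : ∀ s, deriv h (-s) / (h (-s) - x) = -(deriv h s / (h s - x)) := fun s => by
    rw [hodd, congrFun heven s, neg_div]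
  simp only [h4, neg_neg, intervalIntegral.integral_neg] at h3
  have h5 : ∫ s in (-L)..L, deriv h s / (h s - x) = 0 := by
    have := self_eq_neg.1 h3.symm
    exact this
  rw [show d - L - d = -L by ring, show d + L - d = L by ring, h5] at h2
  exact h2

lemma IsNullLoop.exists_insert {β c : ℝ → ℂ} {ℓ L t₀ : ℝ} (hβ : IsNullLoop β ℓ)
    (hc : LipschitzOnWith 1 c (Ici 0)) (hL : 0 ≤ L) (ht₀ : t₀ ∈ Icc 0 ℓ) (hcL : c L = β t₀) :
    ∃ β' : ℝ → ℂ, IsNullLoop β' (ℓ + 2 * L) ∧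
      β' '' Icc 0 (ℓ + 2 * L) = β '' Icc 0 ℓ ∪ c '' Icc 0 L := by
  obtain ⟨h0, h1⟩ := ht₀
  set d := t₀ + L with hd
  set g : ℝ → ℂ := fun t => c |t - d| with hg
  set k : ℝ → ℂ := fun t => β (t - 2 * L) with hk
  set f : ℝ → ℂ := fun t => if t ≤ t₀ then β t else if t ≤ t₀ + 2 * L then g t else k t with hf
  have hgl : LipschitzWith 1 g := by
    have : LipschitzWith 1 fun t : ℝ => |t - d| := LipschitzWith.of_dist_le_mul fun s t => by
      simp only [Real.dist_eq, NNReal.coe_one, one_mul]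
      calc |(|s - d| - |t - d|)| ≤ |s - d - (t - d)| := abs_abs_sub_abs_le_abs_sub _ _
        _ = |s - t| := by ring_nf
    have h2 := hc.comp (g := c) (this.lipschitzOnWith (s := univ)) (fun t _ => mem_Ici.2 (abs_nonneg _))
    rw [mul_one] at h2
    exact lipschitzOnWith_univ.1 h2
  have hkl : LipschitzWith 1 k := LipschitzWith.of_dist_le_mul fun s t => by
    simpa [Real.dist_eq] using hβ.lipschitz.dist_le_mul (s - 2 * L) (t - 2 * L)
  have hg1 : g t₀ = β t₀ := by
    simp only [hg, hd]; rw [show t₀ - (t₀ + L) = -L by ring, abs_neg, abs_of_nonneg hL, hcL]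
  have hg2 : g (t₀ + 2 * L) = β t₀ := by
    simp only [hg, hd]; rw [show t₀ + 2 * L - (t₀ + L) = L by ring, abs_of_nonneg hL, hcL]
  have hk2 : k (t₀ + 2 * L) = β t₀ := by simp [hk]
  have hfl : LipschitzWith 1 f := by
    refine hβ.lipschitz.ite_le (hgl.ite_le hkl (hg2.trans hk2.symm)) ?_
    simp [hL, hg1]
  have fβ : ∀ t, t ≤ t₀ → f t = β t := fun t ht => by simp [hf, ht]
  have fg : ∀ t, t₀ ≤ t → t ≤ t₀ + 2 * L → f t = g t := fun t ht ht' => by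
    rcases ht.eq_or_lt with rfl | ht
    · simp [hf, hg1]
    · simp [hf, not_le.2 ht, ht']
  have fk : ∀ t, t₀ + 2 * L ≤ t → f t = k t := fun t ht => by
    rcases ht.eq_or_lt with rfl | ht
    · rw [fg _ (by linarith) le_rfl, hg2, hk2]
    · simp [hf, not_le.2 ht, not_le.2 (show t₀ < t by linarith)]
  have himage : f '' Icc 0 (ℓ + 2 * L) = β '' Icc 0 ℓ ∪ c '' Icc 0 L := by
    refine Subset.antisymm ?_ (union_subset ?_ ?_)
    · rintro _ ⟨t, ⟨ht0, ht1⟩, rfl⟩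
      rcases le_total t t₀ with h | h
      · exact Or.inl ⟨t, ⟨ht0, h.trans h1⟩, (fβ t h).symm⟩
      rcases le_total t (t₀ + 2 * L) with h' | h'
      · refine Or.inr ⟨|t - d|, ⟨abs_nonneg _, ?_⟩, (fg t h h').symm⟩
        rw [abs_le]; constructor <;> linarith
      · exact Or.inl ⟨t - 2 * L, ⟨by linarith, by linarith⟩, (fk t h').symm⟩
    · rintro _ ⟨t, ⟨ht0, ht1⟩, rfl⟩
      rcases le_total t t₀ with h | h
      · exact ⟨t, ⟨ht0, by linarith⟩, fβ t h⟩
      · exact ⟨t + 2 * L, ⟨by linarith, by linarith⟩, by rw [fk _ (by linarith)]; simp [hk]⟩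
    · rintro _ ⟨t, ⟨ht0, ht1⟩, rfl⟩
      refine ⟨d + t, ⟨by linarith, by linarith⟩, ?_⟩
      rw [fg _ (by linarith) (by linarith)]
      simp [hg, abs_of_nonneg ht0]
  refine ⟨f, ⟨by linarith [hβ.nonneg], hfl, ?_, fun x hx => ?_⟩, himage⟩
  · rw [fβ _ h0, fk _ (by linarith)]
    simp [hk, hβ.closed]
  · have hx' : x ∉ β '' Icc 0 ℓ := fun h => hx (himage ▸ Or.inl h)
    have hint : ∀ a b, 0 ≤ a → a ≤ b → b ≤ ℓ + 2 * L →
        IntervalIntegrable (fun t => deriv f t / (f t - x)) volume a b := fun a b ha hab hb =>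
      intervalIntegrable_deriv_div hfl hab fun h =>
        hx (image_mono (Icc_subset_Icc ha hb) h)
    have hintβ : ∀ a b, 0 ≤ a → a ≤ b → b ≤ ℓ →
        IntervalIntegrable (fun t => deriv β t / (β t - x)) volume a b := fun a b ha hab hb =>
      intervalIntegrable_deriv_div hβ.lipschitz hab fun h =>
        hx' (image_mono (Icc_subset_Icc ha hb) h)
    rw [← intervalIntegral.integral_add_adjacent_intervals (b := t₀ + 2 * L)
        (hint _ _ le_rfl (by linarith) (by linarith))
        (hint _ _ (by linarith) (by linarith) le_rfl),
      ← intervalIntegral.integral_add_adjacent_intervals (b := t₀)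
        (hint _ _ le_rfl (by linarith) (by linarith))
        (hint _ _ (by linarith) (by linarith) (by linarith)),
      integral_deriv_div_congr h0 (fun t ht => fβ t ht.2.le),
      integral_deriv_div_congr (g := g) (by linarith) (fun t ht => fg t ht.1.le ht.2.le),
      integral_deriv_div_congr (g := k) (by linarith) (fun t ht => fk t ht.1.le)]
    have e1 := integral_comp_abs_eq_zero c d L x
    rw [show d - L = t₀ by rw [hd]; ring, show d + L = t₀ + 2 * L by rw [hd]; ring] at e1
    have e2 : ∫ t in (t₀ + 2 * L)..(ℓ + 2 * L), deriv k t / (k t - x)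
        = ∫ t in t₀..ℓ, deriv β t / (β t - x) := by
      have := intervalIntegral.integral_comp_sub_right (a := t₀ + 2 * L) (b := ℓ + 2 * L)
        (fun s => deriv β s / (β s - x)) (2 * L)
      rw [add_sub_cancel_right, add_sub_cancel_right] at this
      rw [← this]
      simp only [hk, deriv_comp_sub_const]
    rw [e1, e2, add_zero, intervalIntegral.integral_add_adjacent_intervals
      (hintβ _ _ le_rfl h0 h1) (hintβ _ _ h0 h1 le_rfl)]
    exact hβ.integral_eq_zero x hx'

lemma IsNullLoop.exists_inClass {β : ℝ → ℂ} {ℓ : ℝ} (hβ : IsNullLoop β ℓ) {S : Set ℂ}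
    (hS : S ⊆ β '' Icc 0 ℓ) : ∃ γ, InClass S γ ∧ curveLength γ ≤ ℓ := by
  have hℓ := hβ.nonneg
  set γ : ℝ → ℂ := fun t => β (ℓ * Int.fract t) with hγ
  have hβd : ∀ u v, 0 ≤ v → v ≤ u → dist (β (ℓ * u)) (β (ℓ * (u - v))) ≤ ℓ * v := by
    intro u v hv _
    have := hβ.lipschitz.dist_le_mul (ℓ * u) (ℓ * (u - v))
    rw [Real.dist_eq, show ℓ * u - ℓ * (u - v) = ℓ * v by ring,
      abs_of_nonneg (mul_nonneg hℓ hv)] at this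
    simpa using this
  have key : ∀ s t, s ≤ t → dist (γ s) (γ t) ≤ ℓ * (t - s) := by
    intro s t hst
    have hs := Int.self_sub_floor s
    have ht := Int.self_sub_floor t
    have hs1 := (Int.fract_lt_one s).le
    have ht0 := Int.fract_nonneg t
    have hs0 := Int.fract_nonneg s
    rcases (Int.floor_mono hst).eq_or_lt with h | h
    · rw [h] at hs
      have := hβd (Int.fract t) (t - s) (by linarith) (by linarith)
      rw [show Int.fract t - (t - s) = Int.fract s by linarith] at this
      rw [dist_comm]; exact this
    · have h' : (⌊s⌋ : ℝ) + 1 ≤ ⌊t⌋ := by exact_mod_cast h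
      have e1 := hβd 1 (1 - Int.fract s) (by linarith) (by linarith)
      have e2 := hβd (Int.fract t) (Int.fract t) ht0 le_rfl
      rw [sub_sub_cancel, mul_one, ← hβ.closed, dist_comm] at e1
      rw [sub_self, mul_zero, dist_comm] at e2
      have e3 := dist_triangle (γ s) (β 0) (γ t)
      have e4 : ℓ * (1 - Int.fract s) + ℓ * Int.fract t ≤ ℓ * (t - s) := by
        rw [← mul_add]
        exact mul_le_mul_of_nonneg_left (by linarith) hℓ
      simp only [hγ] at e3 ⊢
      linarith
  have hlip : LipschitzWith ℓ.toNNReal γ := LipschitzWith.of_dist_le_mul fun s t => by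
    rw [Real.coe_toNNReal _ hℓ]
    rcases le_total s t with h | h
    · rw [dist_comm s t, Real.dist_eq, abs_of_nonneg (sub_nonneg.2 h)]
      exact key s t h
    · rw [dist_comm, Real.dist_eq, abs_of_nonneg (sub_nonneg.2 h)]
      exact key t s h
  have hrange : β '' Icc 0 ℓ ⊆ range γ := by
    rintro _ ⟨t, ⟨ht0, ht1⟩, rfl⟩
    rcases ht1.eq_or_lt with rfl | ht1
    · exact ⟨0, by simp [hγ, hβ.closed]⟩
    · have hpos : 0 < ℓ := ht0.trans_lt ht1
      refine ⟨t / ℓ, ?_⟩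
      simp only [hγ]
      rw [Int.fract_eq_self.2 ⟨by positivity, (div_lt_one hpos).2 ht1⟩, mul_div_cancel₀ _ hpos.ne']
  refine ⟨γ, ⟨fun t => by simp [hγ], ⟨_, hlip⟩, hS.trans hrange, fun x hx => ?_⟩, ?_⟩
  · have hx' : x ∉ β '' Icc 0 ℓ := fun h => hx (hrange h)
    have heq : EqOn γ (fun t => β (ℓ * t)) (Ioo 0 1) := fun t ht => by
      simp only [hγ]
      rw [Int.fract_eq_self.2 ⟨ht.1.le, ht.2⟩]
    rw [winding, integral_deriv_div_congr zero_le_one heq]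
    have h1 := intervalIntegral.smul_integral_comp_mul_left (a := 0) (b := 1)
      (fun s => deriv β s / (β s - x)) ℓ
    rw [mul_zero, mul_one, hβ.integral_eq_zero x hx', ← intervalIntegral.integral_smul] at h1
    simp only [deriv_comp_mul_left, smul_div_assoc, h1, mul_zero]
  · have h1 : ∀ t ∈ Set.uIoc (0 : ℝ) 1, ‖‖deriv γ t‖‖ ≤ ℓ := fun t _ => by
      have := norm_deriv_le_of_lipschitz (x₀ := t) hlip
      rw [Real.coe_toNNReal _ hℓ] at this
      simpa using this
    have := intervalIntegral.norm_integral_le_of_norm_le_const h1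
    rw [sub_zero, abs_one, mul_one] at this
    exact (le_abs_self _).trans this

lemma exists_isNullLoop {K S : Set ℂ} (hS : S.Finite) (hKc : IsCompact K) (hK : IsConnected K)
    (hfin : H1 K ≠ ⊤) (hSK : S ⊆ K) : ∀ ε : ℝ, 0 < ε → ∃ β ℓ, IsNullLoop β ℓ ∧ S ⊆ β '' Icc 0 ℓ ∧
      β '' Icc 0 ℓ ⊆ K ∧ ENNReal.ofReal ℓ ≤ 2 * H1 (β '' Icc 0 ℓ) + ENNReal.ofReal ε := by
  induction S, hS using Set.Finite.induction_on with
  | empty =>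
    intro ε hε
    obtain ⟨p, hp⟩ := hK.nonempty
    refine ⟨fun _ => p, 0, ⟨le_rfl, LipschitzWith.const' p, rfl, by simp⟩, by simp, ?_, by simp⟩
    rintro _ ⟨_, _, rfl⟩
    exact hp
  | @insert x S _ _ ih =>
    intro ε hε
    obtain ⟨β, ℓ, hβ, hSβ, hβK, hℓ⟩ := ih ((subset_insert x S).trans hSK) (ε / 2) (by positivity)
    have hxK : x ∈ K := hSK (mem_insert x S)
    set G := β '' Icc 0 ℓ with hG
    have hGc : IsCompact G := isCompact_Icc.image hβ.lipschitz.continuous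
    have hGn : G.Nonempty := (nonempty_Icc.2 hβ.nonneg).image β
    have hGconn : IsPreconnected G :=
      isPreconnected_Icc.image _ hβ.lipschitz.continuous.continuousOn
    have hlt : ∀ K' ⊆ K, H1 (K' \ G) ≠ ⊤ := fun K' hK' =>
      ((measure_mono (sdiff_subset.trans hK')).trans_lt (lt_top_iff_ne_top.2 hfin)).ne
    obtain ⟨L₀, hL₀, -⟩ := exists_joinedBy hKc hK.isPreconnected hGc.isClosed
      (by rwa [inter_eq_right.2 hβK]) (hlt K le_rfl) hxK
    have hbdd : BddBelow {L | JoinedBy K G x L} := ⟨0, fun _ h => h.1⟩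
    obtain ⟨L, ⟨hL, c, hc, hcK, hc0, hcL⟩, hLlt⟩ := exists_lt_of_csInf_lt (⟨L₀, hL₀⟩ :
      {L | JoinedBy K G x L}.Nonempty) (lt_add_of_pos_right _ (show 0 < ε / 4 by positivity))
    obtain ⟨t₀, ht₀, hct₀⟩ := hcL
    obtain ⟨β', hβ', himage⟩ := hβ.exists_insert hc hL ht₀ hct₀.symm
    have hc_cont : ContinuousOn c (Icc 0 L) := hc.continuousOn.mono Icc_subset_Ici_self
    have hG'c : IsCompact (G ∪ c '' Icc 0 L) := hGc.union (isCompact_Icc.image_of_continuousOn hc_cont)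
    have hG'K : G ∪ c '' Icc 0 L ⊆ K := union_subset hβK (by
      rintro _ ⟨t, ht, rfl⟩; exact hcK t ht.1)
    have hxG' : x ∈ G ∪ c '' Icc 0 L := Or.inr ⟨0, ⟨le_rfl, hL⟩, hc0⟩
    have hG'conn : IsPreconnected (G ∪ c '' Icc 0 L) :=
      IsPreconnected.union (c L) ⟨t₀, ht₀, hct₀⟩ ⟨L, ⟨hL, le_rfl⟩, rfl⟩ hGconn
        (isPreconnected_Icc.image _ hc_cont)
    obtain ⟨L', hL', hL'le⟩ := exists_joinedBy hG'c hG'conn hGc.isClosed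
      (by rwa [inter_eq_right.2 subset_union_left]) (hlt _ hG'K) hxG'
    have hLL' : L ≤ L' + ε / 4 :=
      hLlt.le.trans (by gcongr; exact csInf_le hbdd (hL'.mono hG'K))
    refine ⟨β', _, hβ', ?_, himage ▸ hG'K, ?_⟩
    · rw [himage]
      exact insert_subset hxG' (hSβ.trans subset_union_left)
    · rw [himage]
      have hsplit : H1 (G ∪ c '' Icc 0 L) = H1 G + H1 ((G ∪ c '' Icc 0 L) \ G) := by
        rw [← measure_inter_add_sdiff (G ∪ c '' Icc 0 L) hGc.measurableSet,
          inter_eq_right.2 subset_union_left]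
      calc ENNReal.ofReal (ℓ + 2 * L)
          ≤ ENNReal.ofReal (ℓ + 2 * (L' + ε / 4)) := ENNReal.ofReal_le_ofReal (by linarith)
        _ = ENNReal.ofReal ℓ + (2 * ENNReal.ofReal L' + ENNReal.ofReal (ε / 2)) := by
          have h2 : (2 : ENNReal) = ENNReal.ofReal 2 := by simp
          rw [h2, ← ENNReal.ofReal_mul zero_le_two, ← ENNReal.ofReal_add, ← ENNReal.ofReal_add]
          · congr 1; ring
          all_goals linarith [hβ.nonneg, hL'.1]
        _ ≤ (2 * H1 G + ENNReal.ofReal (ε / 2)) +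
            (2 * H1 ((G ∪ c '' Icc 0 L) \ G) + ENNReal.ofReal (ε / 2)) := by gcongr
        _ = 2 * H1 (G ∪ c '' Icc 0 L) + ENNReal.ofReal ε := by
          rw [hsplit, mul_add, add_add_add_comm, ← ENNReal.ofReal_add (by linarith) (by linarith),
            add_halves]

lemma exists_inClass_curveLength_le {K S : Set ℂ} (hS : S.Finite) (hKc : IsCompact K)
    (hK : IsConnected K) (hfin : H1 K ≠ ⊤) (hSK : S ⊆ K) {ε : ℝ} (hε : 0 < ε) :
    ∃ γ, InClass S γ ∧ ENNReal.ofReal (curveLength γ) ≤ 2 * H1 K + ENNReal.ofReal ε := by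
  obtain ⟨β, ℓ, hβ, hSβ, hβK, hℓ⟩ := exists_isNullLoop hS hKc hK hfin hSK ε hε
  obtain ⟨γ, hγ, hlen⟩ := hβ.exists_inClass hSβ
  refine ⟨γ, hγ, (ENNReal.ofReal_le_ofReal hlen).trans (hℓ.trans ?_)⟩
  gcongr

lemma intervalIntegrable_norm_deriv {β : ℝ → ℂ} {C : NNReal} (hβ : LipschitzWith C β) (a b : ℝ) :
    IntervalIntegrable (fun t => ‖deriv β t‖) volume a b := by
  refine (intervalIntegrable_const (c := (C : ℝ))).mono_fun
    (measurable_deriv β).norm.aestronglyMeasurable (Eventually.of_forall fun t => ?_)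
  simpa using norm_deriv_le_of_lipschitz hβ

lemma LipschitzWith.dist_le_integral_norm_deriv {β : ℝ → ℂ} {C : NNReal} (hβ : LipschitzWith C β)
    {s t : ℝ} (hst : s ≤ t) : dist (β s) (β t) ≤ ∫ r in s..t, ‖deriv β r‖ := by
  rcases eq_or_ne (β t) (β s) with h | h
  · rw [h, dist_self]
    exact intervalIntegral.integral_nonneg hst fun _ _ => norm_nonneg _
  set v := β t - β s with hv
  have hv0 : 0 < ‖v‖ := norm_pos_iff.2 (sub_ne_zero.2 h)
  set l : ℂ →L[ℝ] ℝ := innerSL ℝ v with hl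
  have hlip : LipschitzOnWith (‖l‖₊ * C) (fun r => l (β r)) (uIcc s t) :=
    (l.lipschitz.comp hβ).lipschitzOnWith
  have hftc := hlip.absolutelyContinuousOnInterval.integral_deriv_eq_sub
  have hle : ∀ᵐ r, deriv (fun r => l (β r)) r ≤ ‖v‖ * ‖deriv β r‖ := by
    filter_upwards [hβ.ae_differentiableAt_real] with r hr
    have h1 : HasDerivAt (fun r => l (β r)) (l (deriv β r)) r :=
      l.hasFDerivAt.comp_hasDerivAt r hr.hasDerivAt
    rw [h1.deriv]
    exact real_inner_le_norm v (deriv β r)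
  have h2 : l (β t) - l (β s) ≤ ∫ r in s..t, ‖v‖ * ‖deriv β r‖ := by
    rw [← hftc]
    exact intervalIntegral.integral_mono_ae hst
      hlip.absolutelyContinuousOnInterval.intervalIntegrable_deriv
      ((intervalIntegrable_norm_deriv hβ s t).const_mul _) hle
  rw [← map_sub, ← hv, intervalIntegral.integral_const_mul, hl, innerSL_apply_apply,
    real_inner_self_eq_norm_mul_norm] at h2
  rw [dist_comm, dist_eq_norm, ← hv]
  exact le_of_mul_le_mul_left h2 hv0

/-- A map which is `1`-Lipschitz with respect to a reparametrization `F` satisfies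
`H1 (β '' T) ≤ volume (F '' T)`. -/
lemma H1_image_le_volume_image {β : ℝ → ℂ} {F : ℝ → ℝ}
    (h : ∀ s t, dist (β s) (β t) ≤ dist (F s) (F t)) (T : Set ℝ) :
    H1 (β '' T) ≤ volume (F '' T) := by
  set g : ℝ → ℂ := fun y => β (Function.invFunOn F T y) with hg
  have hg1 : LipschitzOnWith 1 g (F '' T) := LipschitzOnWith.of_dist_le_mul fun y hy y' hy' => by
    have := h (Function.invFunOn F T y) (Function.invFunOn F T y')
    rw [Function.invFunOn_eq hy, Function.invFunOn_eq hy'] at this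
    simpa using this
  have himage : β '' T = g '' (F '' T) := by
    rw [image_image]
    refine image_congr fun t ht => ?_
    have h1 := h t (Function.invFunOn F T (F t))
    rw [Function.invFunOn_eq (mem_image_of_mem F ht), dist_self] at h1
    exact dist_le_zero.1 h1
  rw [himage, ← hausdorffMeasure_real]
  simpa [H1] using hg1.hausdorffMeasure_image_le (d := 1) zero_le_one

section arclength

variable {β : ℝ → ℂ} {C : NNReal}

lemma dist_le_dist_arclength (hβ : LipschitzWith C β) (s t : ℝ) :
    dist (β s) (β t) ≤
      dist (∫ r in (0 : ℝ)..s, ‖deriv β r‖) (∫ r in (0 : ℝ)..t, ‖deriv β r‖) := by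
  have key : ∀ s t, s ≤ t → dist (β s) (β t) ≤
      dist (∫ r in (0 : ℝ)..s, ‖deriv β r‖) (∫ r in (0 : ℝ)..t, ‖deriv β r‖) := by
    intro s t hst
    refine (hβ.dist_le_integral_norm_deriv hst).trans ?_
    rw [dist_comm, Real.dist_eq, intervalIntegral.integral_interval_sub_left
      (intervalIntegrable_norm_deriv hβ _ _) (intervalIntegrable_norm_deriv hβ _ _)]
    exact le_abs_self _
  rcases le_total s t with h | h
  · exact key s t h
  · rw [dist_comm, dist_comm (∫ r in (0 : ℝ)..s, ‖deriv β r‖)]; exact key t s h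

lemma H1_image_Icc_le (hβ : LipschitzWith C β) {a b : ℝ} :
    H1 (β '' Icc a b) ≤ ∫⁻ t in Ioc a b, ENNReal.ofReal ‖deriv β t‖ := by
  rcases lt_or_ge b a with hab | hab
  · simp [Icc_eq_empty (not_le.2 hab)]
  set F : ℝ → ℝ := fun s => ∫ r in (0 : ℝ)..s, ‖deriv β r‖ with hF
  have hsub : ∀ s t, F t - F s = ∫ r in s..t, ‖deriv β r‖ := fun s t =>
    intervalIntegral.integral_interval_sub_left
      (intervalIntegrable_norm_deriv hβ _ _) (intervalIntegrable_norm_deriv hβ _ _)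
  have hmono : Monotone F := fun s t hst => by
    rw [← sub_nonneg, hsub]
    exact intervalIntegral.integral_nonneg hst fun _ _ => norm_nonneg _
  calc H1 (β '' Icc a b) ≤ volume (F '' Icc a b) :=
        H1_image_le_volume_image (dist_le_dist_arclength hβ) _
    _ ≤ volume (Icc (F a) (F b)) := measure_mono (image_subset_iff.2 fun t ht => ⟨hmono ht.1, hmono ht.2⟩)
    _ = ENNReal.ofReal (∫ r in a..b, ‖deriv β r‖) := by rw [Real.volume_Icc, hsub]
    _ = ∫⁻ t in Ioc a b, ENNReal.ofReal ‖deriv β t‖ := by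
      rw [intervalIntegral.integral_of_le hab, ofReal_integral_eq_lintegral_ofReal
        (intervalIntegrable_norm_deriv hβ a b).1 (Eventually.of_forall fun _ => norm_nonneg _)]

lemma H1_image_eq_zero_of_volume (hβ : LipschitzWith C β) {T : Set ℝ} (hT : volume T = 0) :
    H1 (β '' T) = 0 := by
  have := hβ.hausdorffMeasure_image_le (d := 1) zero_le_one T
  rw [hausdorffMeasure_real, hT, mul_zero] at this
  exact le_antisymm this zero_le

lemma H1_image_eq_zero_of_deriv (hβ : LipschitzWith C β) {T : Set ℝ}
    (hT : ∀ᵐ t, t ∈ T → deriv β t = 0) : H1 (β '' T) = 0 := by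
  set F : ℝ → ℝ := fun s => ∫ r in (0 : ℝ)..s, ‖deriv β r‖ with hF
  have hloc : LocallyIntegrable (fun t => ‖deriv β t‖) volume := by
    refine (locallyIntegrable_const (C : ℝ)).mono (measurable_deriv β).norm.aestronglyMeasurable
      (Eventually.of_forall fun t => ?_)
    simpa using norm_deriv_le_of_lipschitz hβ
  have hae : ∀ᵐ t, t ∈ T → HasDerivAt F 0 t := by
    filter_upwards [hT, _root_.LocallyIntegrable.ae_hasDerivAt_integral hloc] with t h1 h2 ht
    have := h2 0
    rwa [h1 ht, norm_zero] at this
  set N : Set ℝ := {t | ¬ (t ∈ T → HasDerivAt F 0 t)} with hN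
  have h1 : H1 (β '' N) = 0 := H1_image_eq_zero_of_volume hβ (ae_iff.1 hae)
  have h2 : H1 (β '' (T \ N)) = 0 := by
    refine le_antisymm ((H1_image_le_volume_image (dist_le_dist_arclength hβ) _).trans ?_) zero_le
    refine (addHaar_image_eq_zero_of_det_fderivWithin_eq_zero volume (f := F)
      (f' := fun _ => 0) (s := T \ N) (fun t ht => ?_) fun t _ => ?_).le
    · have h3 : HasDerivAt F 0 t := (not_not.1 ht.2) ht.1
      have := h3.hasFDerivAt
      simp only [ContinuousLinearMap.toSpanSingleton_zero] at this
      exact this.hasFDerivWithinAt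
    · simp
  refine measure_mono_null ?_ (measure_union_null h1 h2)
  rw [← image_union, union_sdiff_self]
  exact image_mono subset_union_right

end arclength

open scoped Real

lemma polarCoord_symm_eq_circleMap (p : ℝ × ℝ) :
    Complex.polarCoord.symm p = circleMap 0 p.1 p.2 := by
  rw [Complex.polarCoord_symm_apply, circleMap, zero_add, Complex.exp_mul_I]
  push_cast
  rfl

lemma lintegral_enorm_inv_ball_ne_top :
    ∫⁻ w : ℂ in Metric.ball 0 1, ‖w⁻¹‖ₑ ≠ ⊤ := by
  rw [← lintegral_indicator Metric.isOpen_ball.measurableSet,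
    ← Complex.lintegral_comp_polarCoord_symm]
  have hle : ∀ p ∈ polarCoord.target, ENNReal.ofReal p.1 •
      (Metric.ball (0 : ℂ) 1).indicator (fun w => ‖w⁻¹‖ₑ) (Complex.polarCoord.symm p) ≤
      (Ioo (0 : ℝ) 1 ×ˢ Ioo (-π) π).indicator 1 p := by
    rintro p ⟨hp1, hp2⟩
    have hp1 : 0 < p.1 := hp1
    have hn : ‖Complex.polarCoord.symm p‖ = p.1 := by
      rw [Complex.norm_polarCoord_symm, abs_of_pos hp1]
    by_cases h : p.1 < 1
    · rw [indicator_of_mem (by rwa [mem_ball_zero_iff, hn]),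
        indicator_of_mem (show p ∈ Ioo (0 : ℝ) 1 ×ˢ Ioo (-π) π from ⟨⟨hp1, h⟩, hp2⟩),
        ← ofReal_norm, norm_inv, hn, smul_eq_mul, ← ENNReal.ofReal_mul hp1.le,
        mul_inv_cancel₀ hp1.ne', ENNReal.ofReal_one]
      rfl
    · rw [indicator_of_notMem (by rwa [mem_ball_zero_iff, hn])]
      simp
  refine ne_top_of_le_ne_top ?_ (setLIntegral_mono' polarCoord.open_target.measurableSet hle)
  refine ne_top_of_le_ne_top ?_ (setLIntegral_le_lintegral _ _)
  rw [lintegral_indicator_one (measurableSet_Ioo.prod measurableSet_Ioo), Measure.volume_eq_prod,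
    Measure.prod_prod]
  simp

lemma exists_lintegral_enorm_inv_sub_le (r : ℝ) :
    ∃ M : ENNReal, M ≠ ⊤ ∧ ∀ z : ℂ, ∫⁻ w in Metric.ball 0 r, ‖(w - z)⁻¹‖ₑ ≤ M := by
  refine ⟨(∫⁻ w : ℂ in Metric.ball 0 1, ‖w⁻¹‖ₑ) + volume (Metric.ball (0 : ℂ) r),
    ENNReal.add_ne_top.2 ⟨lintegral_enorm_inv_ball_ne_top, measure_ball_lt_top.ne⟩, fun z => ?_⟩
  have hle : ∀ w : ℂ, ‖(w - z)⁻¹‖ₑ ≤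
      (Metric.ball (0 : ℂ) 1).indicator (fun w => ‖w⁻¹‖ₑ) (w - z) + 1 := by
    intro w
    by_cases h : w - z ∈ Metric.ball (0 : ℂ) 1
    · rw [indicator_of_mem h]; exact le_self_add
    · rw [indicator_of_notMem h, zero_add, ← ofReal_norm, ENNReal.ofReal_le_one, norm_inv]
      exact inv_le_one_of_one_le₀ (by simpa using h)
  have hm : Measurable ((Metric.ball (0 : ℂ) 1).indicator fun w => ‖w⁻¹‖ₑ) :=
    measurable_inv.enorm.indicator Metric.isOpen_ball.measurableSet
  calc ∫⁻ w in Metric.ball 0 r, ‖(w - z)⁻¹‖ₑ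
      ≤ ∫⁻ w in Metric.ball 0 r,
        ((Metric.ball (0 : ℂ) 1).indicator (fun w => ‖w⁻¹‖ₑ) (w - z) + 1) :=
        lintegral_mono fun w => hle w
    _ = (∫⁻ w in Metric.ball 0 r, (Metric.ball (0 : ℂ) 1).indicator (fun w => ‖w⁻¹‖ₑ) (w - z)) +
        volume (Metric.ball (0 : ℂ) r) := by
      rw [lintegral_add_right _ measurable_const, setLIntegral_one]
    _ ≤ _ := by
      refine add_le_add_left ?_ _
      refine (setLIntegral_le_lintegral _ _).trans ?_
      rw [lintegral_sub_right_eq_self ((Metric.ball (0 : ℂ) 1).indicator fun w => ‖w⁻¹‖ₑ) z,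
        lintegral_indicator Metric.isOpen_ball.measurableSet]

lemma integrableOn_inv_sub (r : ℝ) (z : ℂ) :
    IntegrableOn (fun w : ℂ => (w - z)⁻¹) (Metric.ball 0 r) := by
  obtain ⟨M, hM, h⟩ := exists_lintegral_enorm_inv_sub_le r
  exact ⟨(measurable_id.sub_const z).inv.aestronglyMeasurable, (h z).trans_lt hM.lt_top⟩

lemma integral_circleMap_div_sub (z : ℂ) {ρ : ℝ} (hρ : 0 < ρ) (hz : ‖z‖ ≠ ρ) :
    ∫ θ in Ioo (-π) π, circleMap 0 ρ θ / (circleMap 0 ρ θ - z) =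
      if ‖z‖ < ρ then 2 * (π : ℂ) else 0 := by
  have hper : Function.Periodic (fun θ => circleMap 0 ρ θ / (circleMap 0 ρ θ - z)) (2 * π) :=
    fun θ => by simp only [periodic_circleMap 0 ρ θ]
  have h1 : ∫ θ in Ioo (-π) π, circleMap 0 ρ θ / (circleMap 0 ρ θ - z) =
      ∫ θ in (0 : ℝ)..2 * π, circleMap 0 ρ θ / (circleMap 0 ρ θ - z) := by
    rw [← integral_Ioc_eq_integral_Ioo, ← intervalIntegral.integral_of_le (by linarith [Real.pi_pos])]
    have := hper.intervalIntegral_add_eq (-π) 0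
    rw [zero_add] at this
    rw [← this]
    congr 1
    ring
  have h2 : (∮ w in C(0, ρ), (w - z)⁻¹) =
      Complex.I * ∫ θ in (0 : ℝ)..2 * π, circleMap 0 ρ θ / (circleMap 0 ρ θ - z) := by
    rw [circleIntegral, ← intervalIntegral.integral_const_mul]
    refine intervalIntegral.integral_congr fun θ _ => ?_
    simp only [deriv_circleMap, smul_eq_mul]
    ring
  rw [h1]
  refine mul_left_cancel₀ Complex.I_ne_zero ?_
  rw [← h2]
  split_ifs with h
  · rw [circleIntegral.integral_sub_inv_of_mem_ball (by simpa using h)]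
    ring
  · have hlt : ρ < ‖z‖ := lt_of_le_of_ne (not_lt.1 h) hz.symm
    rw [mul_zero]
    have hne : ∀ w ∈ Metric.closedBall (0 : ℂ) ρ, w - z ≠ 0 := by
      rintro w hw h0
      rw [mem_closedBall_zero_iff, sub_eq_zero.1 h0] at hw
      exact absurd hw (not_le.2 hlt)
    refine Complex.circleIntegral_eq_zero_of_differentiable_on_off_countable hρ.le
      countable_empty ((continuousOn_id.sub continuousOn_const).inv₀ hne) fun w hw => ?_
    exact (differentiableAt_id.sub_const z).inv (hne w (Metric.ball_subset_closedBall hw.1))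

/-- The cone-like kernel whose Cauchy transform representation is explicit. -/
lemma integral_ball_div_sub {r : ℝ} (hr : 0 < r) (z : ℂ) :
    ∫ w in Metric.ball 0 r, w / (w - z) = π * (max (r ^ 2 - ‖z‖ ^ 2) 0 : ℝ) := by
  set f : ℂ → ℂ := (Metric.ball (0 : ℂ) r).indicator fun w => w / (w - z) with hf
  have hfi : Integrable f := by
    rw [hf, integrable_indicator_iff Metric.isOpen_ball.measurableSet]
    refine ((integrableOn_inv_sub r z).norm.const_mul r).mono'
      (measurable_id.div (measurable_id.sub_const z)).aestronglyMeasurable ?_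
    filter_upwards [ae_restrict_mem Metric.isOpen_ball.measurableSet] with w hw
    rw [div_eq_mul_inv, norm_mul]
    exact mul_le_mul_of_nonneg_right (mem_ball_zero_iff.1 hw).le (norm_nonneg _)
  have hpi : IntegrableOn (fun p : ℝ × ℝ => p.1 • f (Complex.polarCoord.symm p))
      (Ioi 0 ×ˢ Ioo (-π) π) (volume.prod volume) := by
    rw [← Measure.volume_eq_prod, ← polarCoord_target]
    have hm : Measurable fun p : ℝ × ℝ => p.1 • f (Complex.polarCoord.symm p) := by
      have : Measurable f := (measurable_id.div (measurable_id.sub_const z)).indicator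
        Metric.isOpen_ball.measurableSet
      simp only [polarCoord_symm_eq_circleMap, circleMap]
      fun_prop
    refine ⟨hm.aestronglyMeasurable, ?_⟩
    have h1 := Complex.lintegral_comp_polarCoord_symm fun w => ‖f w‖ₑ
    refine lt_of_eq_of_lt ?_ (h1.trans_lt hfi.2)
    refine setLIntegral_congr_fun polarCoord.open_target.measurableSet fun p hp => ?_
    rw [enorm_smul, Real.enorm_of_nonneg (le_of_lt hp.1), smul_eq_mul]
  rw [← integral_indicator Metric.isOpen_ball.measurableSet, ← hf,
    ← Complex.integral_comp_polarCoord_symm, polarCoord_target, Measure.volume_eq_prod,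
    setIntegral_prod _ hpi]
  have hinner : ∀ᵐ ρ : ℝ ∂volume.restrict (Ioi 0),
      ∫ θ in Ioo (-π) π, ρ • f (Complex.polarCoord.symm (ρ, θ)) =
        (Ioo ‖z‖ r).indicator (fun ρ : ℝ => ((2 * π * ρ : ℝ) : ℂ)) ρ := by
    have hne : ∀ᵐ ρ : ℝ ∂volume.restrict (Ioi 0), ρ ≠ ‖z‖ :=
      ae_restrict_of_ae (Measure.ae_ne volume _)
    filter_upwards [hne, ae_restrict_mem measurableSet_Ioi] with ρ h1 hρ
    have hρ : 0 < ρ := hρ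
    rw [integral_smul]
    simp only [polarCoord_symm_eq_circleMap, hf]
    by_cases h : ρ < r
    · have : ∀ θ, circleMap 0 ρ θ ∈ Metric.ball (0 : ℂ) r := fun θ => by
        simpa [abs_of_pos hρ] using h
      simp only [indicator_of_mem (this _)]
      rw [integral_circleMap_div_sub z hρ h1.symm]
      by_cases hz : ‖z‖ < ρ
      · rw [if_pos hz, indicator_of_mem (show ρ ∈ Ioo ‖z‖ r from ⟨hz, h⟩)]
        simp; ring
      · rw [if_neg hz, indicator_of_notMem fun h => hz h.1, smul_zero]
    · have : ∀ θ, circleMap 0 ρ θ ∉ Metric.ball (0 : ℂ) r := fun θ => by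
        simpa [abs_of_pos hρ] using h
      simp only [indicator_of_notMem (this _)]
      rw [indicator_of_notMem fun h' => h h'.2]
      simp
  rw [integral_congr_ae hinner, setIntegral_indicator measurableSet_Ioo,
    inter_eq_self_of_subset_right
      (show Ioo ‖z‖ r ⊆ Ioi 0 from fun ρ h => (norm_nonneg z).trans_lt h.1), integral_complex_ofReal,
    ← Complex.ofReal_mul]
  congr 1
  rcases le_or_gt r ‖z‖ with h | h
  · rw [Ioo_eq_empty (not_lt.2 h), max_eq_right (by nlinarith [norm_nonneg z])]
    simp
  · rw [← integral_Ioc_eq_integral_Ioo, ← intervalIntegral.integral_of_le h.le,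
      max_eq_left (by nlinarith [norm_nonneg z]), intervalIntegral.integral_const_mul, integral_id]
    ring

section current

variable {β : ℝ → ℂ} {C : NNReal}

lemma volume_range_eq_zero (hβ : LipschitzWith C β) : volume (range β) = 0 := by
  have hdim : dimH (range β) < (2 : NNReal) := by
    refine hβ.dimH_range_le.trans_lt ?_
    rw [Real.dimH_univ]
    exact_mod_cast one_lt_two
  refine measure_zero_of_dimH_lt ?_ hdim
  have h : (Measure.hausdorffMeasure ((2 : NNReal) : ℝ) : Measure ℂ).IsAddHaarMeasure := by
    have := isAddHaarMeasure_hausdorffMeasure (E := ℂ)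
    rwa [Complex.finrank_real_complex] at this
  exact Measure.absolutelyContinuous_isAddHaarMeasure _ _

lemma integral_bump_smul_deriv_eq_zero (hβ : LipschitzWith C β)
    (hw : ∀ x ∉ range β, winding β x = 0) {r : ℝ} (hr : 0 < r) (c : ℂ) :
    ∫ t in Ioc (0 : ℝ) 1, (max (r ^ 2 - ‖β t - c‖ ^ 2) 0) • deriv β t = 0 := by
  have hbm := measurable_deriv β
  have hβm := hβ.continuous.measurable
  set G : ℝ → ℂ → ℂ := fun t w => deriv β t * (w / (w - (β t - c))) with hG
  have hGm : Measurable (Function.uncurry G) := by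
    simp only [hG, Function.uncurry_def]
    fun_prop
  have hGi : Integrable (Function.uncurry G)
      ((volume.restrict (Ioc (0 : ℝ) 1)).prod (volume.restrict (Metric.ball 0 r))) := by
    obtain ⟨M, hM, h⟩ := exists_lintegral_enorm_inv_sub_le r
    refine ⟨hGm.aestronglyMeasurable, ?_⟩
    rw [HasFiniteIntegral, lintegral_prod _ hGm.enorm.aemeasurable]
    have hle : ∀ t, ∫⁻ w in Metric.ball 0 r, ‖G t w‖ₑ ≤ C * ENNReal.ofReal r * M := by
      intro t
      have : ∀ w ∈ Metric.ball (0 : ℂ) r, ‖G t w‖ₑ ≤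
          C * ENNReal.ofReal r * ‖(w - (β t - c))⁻¹‖ₑ := by
        intro w hw
        simp only [hG]
        rw [div_eq_mul_inv, enorm_mul, enorm_mul, ← mul_assoc]
        gcongr
        · rw [← ofReal_norm, ← ENNReal.ofReal_coe_nnreal]
          exact ENNReal.ofReal_le_ofReal (norm_deriv_le_of_lipschitz hβ)
        · rw [← ofReal_norm]
          exact ENNReal.ofReal_le_ofReal (mem_ball_zero_iff.1 hw).le
      refine (setLIntegral_mono' Metric.isOpen_ball.measurableSet this).trans ?_
      rw [lintegral_const_mul' _ _ (ENNReal.mul_ne_top ENNReal.coe_ne_top ENNReal.ofReal_ne_top)]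
      gcongr
      exact h _
    refine (lintegral_mono hle).trans_lt ?_
    rw [lintegral_const]
    refine ENNReal.mul_lt_top (ENNReal.mul_lt_top
      (ENNReal.mul_lt_top ENNReal.coe_lt_top ENNReal.ofReal_lt_top) hM.lt_top) ?_
    simp
  have hinner : ∀ᵐ w : ℂ, ∫ t in Ioc (0 : ℝ) 1, G t w = 0 := by
    have hnull : volume ((fun w : ℂ => w + c) ⁻¹' range β) = 0 := by
      rw [measure_preimage_add_right, volume_range_eq_zero hβ]
    filter_upwards [measure_eq_zero_iff_ae_notMem.1 hnull] with w hwc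
    have h0 := hw _ hwc
    rw [winding, mul_eq_zero, or_iff_right (inv_ne_zero Complex.two_pi_I_ne_zero),
      intervalIntegral.integral_of_le zero_le_one] at h0
    have : ∀ t, G t w = -w * (deriv β t / (β t - (w + c))) := fun t => by
      have : w - (β t - c) = -(β t - (w + c)) := by ring
      simp only [hG]
      rw [this, div_neg]
      ring
    simp only [this, integral_const_mul, h0, mul_zero]
  have hswap := integral_integral_swap hGi
  rw [integral_congr_ae (ae_restrict_of_ae hinner), integral_zero] at hswap
  simp only [hG, integral_const_mul, integral_ball_div_sub hr] at hswap
  have : ∀ t, deriv β t * ((π : ℂ) * (max (r ^ 2 - ‖β t - c‖ ^ 2) 0 : ℝ)) =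
      π * ((max (r ^ 2 - ‖β t - c‖ ^ 2) 0) • deriv β t) := fun t => by
    rw [Complex.real_smul]; ring
  simp only [this, integral_const_mul] at hswap
  exact (mul_eq_zero.1 hswap).resolve_left (by simp [Real.pi_ne_zero])

lemma integral_smul_deriv_eq_zero (hβ : LipschitzWith C β)
    (hw : ∀ x ∉ range β, winding β x = 0) {φ : ℂ → ℝ} (hφ : Continuous φ)
    (hφc : HasCompactSupport φ) : ∫ t in Ioc (0 : ℝ) 1, φ (β t) • deriv β t = 0 := by
  have hbm := measurable_deriv β
  have hβm := hβ.continuous.measurable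
  have hbi : Integrable (deriv β) (volume.restrict (Ioc (0 : ℝ) 1)) :=
    Measure.integrableOn_of_bounded (M := C) (by simp) hbm.aestronglyMeasurable
      (Eventually.of_forall fun _ => norm_deriv_le_of_lipschitz hβ)
  have hφi : Integrable φ := hφ.integrable_of_hasCompactSupport hφc
  suffices h : ∀ ε > 0, ‖∫ t in Ioc (0 : ℝ) 1, φ (β t) • deriv β t‖ ≤ ε * C by
    refine norm_le_zero_iff.1 (le_of_forall_pos_le_add fun ε hε => ?_)
    refine (h (ε / (C + 1)) (by positivity)).trans ?_
    rw [zero_add, div_mul_eq_mul_div, div_le_iff₀ (by positivity)]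
    nlinarith
  intro ε hε
  obtain ⟨r, hr, hφr⟩ := Metric.uniformContinuous_iff.1
    (hφc.uniformContinuous_of_continuous hφ) ε hε
  set k : ℂ → ℝ := fun u => max (r ^ 2 - ‖u‖ ^ 2) 0 with hk
  have hkc : Continuous k := by fun_prop
  have hk0 : ∀ u, 0 ≤ k u := fun u => le_max_right _ _
  have hkr : ∀ u, k u ≤ r ^ 2 := fun u => max_le (by nlinarith [norm_nonneg u]) (sq_nonneg r)
  have hksupp : ∀ u, r ≤ ‖u‖ → k u = 0 := fun u hu => max_eq_right (by nlinarith)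
  have hkcs : HasCompactSupport k := by
    refine HasCompactSupport.intro (isCompact_closedBall (0 : ℂ) r) fun u hu => hksupp u ?_
    simpa using (not_le.1 fun h => hu (mem_closedBall_zero_iff.2 h)).le
  have hki : Integrable k := hkc.integrable_of_hasCompactSupport hkcs
  have hM : 0 < ∫ u, k u := by
    refine hkc.integral_pos_of_hasCompactSupport_nonneg_nonzero hkcs hk0 (x := 0) ?_
    simp [hk, hr.ne']
  have hkxi : ∀ x, Integrable fun c => k (x - c) := fun x => hki.comp_sub_left x
  have hφki : ∀ x, Integrable fun c => φ c * k (x - c) := fun x =>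
    (hφi.mul_const (r ^ 2)).mono (by fun_prop) (Eventually.of_forall fun c => by
      rw [norm_mul, norm_mul]
      gcongr
      rw [Real.norm_of_nonneg (hk0 _), Real.norm_of_nonneg (sq_nonneg r)]
      exact hkr _)
  have happrox : ∀ x, |φ x * (∫ u, k u) - ∫ c, φ c * k (x - c)| ≤ ε * ∫ u, k u := by
    intro x
    rw [← integral_sub_left_eq_self k volume x, ← integral_const_mul, ← integral_const_mul,
      ← integral_sub ((hkxi x).const_mul _) (hφki x)]
    refine norm_integral_le_of_norm_le (G := ℝ) ((hkxi x).const_mul ε) (Eventually.of_forall fun c => ?_)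
    rw [← sub_mul, norm_mul, Real.norm_of_nonneg (hk0 _)]
    rcases lt_or_ge (dist x c) r with h | h
    · exact mul_le_mul_of_nonneg_right (hφr h).le (hk0 _)
    · rw [hksupp _ (by rwa [← dist_eq_norm]), mul_zero, mul_zero]
  have hint : Integrable (Function.uncurry fun (t : ℝ) c => (φ c * k (β t - c)) • deriv β t)
      ((volume.restrict (Ioc (0 : ℝ) 1)).prod volume) := by
    refine ((hbi.norm.mul_prod (hφi.norm)).mul_const (r ^ 2)).mono' ?_ ?_
    · refine Measurable.aestronglyMeasurable ?_
      have := hkc.measurable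
      have := hφ.measurable
      simp only [Function.uncurry_def]
      fun_prop
    · refine Eventually.of_forall fun p => ?_
      simp only [Function.uncurry_def]
      rw [norm_smul, norm_mul, Real.norm_of_nonneg (hk0 _)]
      have h1 := hkr (β p.1 - p.2)
      calc ‖φ p.2‖ * k (β p.1 - p.2) * ‖deriv β p.1‖
          ≤ ‖φ p.2‖ * r ^ 2 * ‖deriv β p.1‖ := by gcongr
        _ = _ := by ring
  have hint' : Integrable (fun t => (∫ c, φ c * k (β t - c)) • deriv β t)
      (volume.restrict (Ioc (0 : ℝ) 1)) := by
    have := hint.integral_prod_left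
    simpa only [Function.uncurry_apply_pair, integral_smul_const] using this
  have hzero : ∫ t in Ioc (0 : ℝ) 1, (∫ c, φ c * k (β t - c)) • deriv β t = 0 := by
    have hswap := integral_integral_swap hint
    simp only [integral_smul_const] at hswap
    rw [hswap]
    simp only [mul_smul, integral_smul]
    simp only [hk, integral_bump_smul_deriv_eq_zero hβ hw hr, smul_zero, integral_zero]
  have hmain : (∫ u, k u) • ∫ t in Ioc (0 : ℝ) 1, φ (β t) • deriv β t =
      ∫ t in Ioc (0 : ℝ) 1, (φ (β t) * (∫ u, k u) - ∫ c, φ c * k (β t - c)) • deriv β t := by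
    have hφb : Integrable (fun t => φ (β t) • deriv β t) (volume.restrict (Ioc (0 : ℝ) 1)) := by
      obtain ⟨B, hB⟩ := hφ.bounded_above_of_compact_support hφc
      exact hbi.bdd_smul B (hφ.measurable.comp hβm).aestronglyMeasurable
        (Eventually.of_forall fun t => hB _)
    simp only [sub_smul, mul_comm _ (∫ u, k u), mul_smul]
    have hsm : Integrable (fun t => (∫ u, k u) • φ (β t) • deriv β t)
      (volume.restrict (Ioc (0 : ℝ) 1)) := hφb.smul (∫ u, k u)
    rw [integral_sub hsm hint', hzero, sub_zero, integral_smul]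
  have hle : ‖(∫ u, k u) • ∫ t in Ioc (0 : ℝ) 1, φ (β t) • deriv β t‖ ≤ ε * (∫ u, k u) * C := by
    rw [hmain]
    refine (norm_integral_le_of_norm_le_const (C := ε * (∫ u, k u) * C)
      (Eventually.of_forall fun t => ?_)).trans (by simp)
    rw [norm_smul]
    exact mul_le_mul (happrox _) (norm_deriv_le_of_lipschitz hβ) (norm_nonneg _) (by positivity)
  rw [norm_smul, Real.norm_of_nonneg hM.le] at hle
  refine le_of_mul_le_mul_left (hle.trans_eq ?_) hM
  ring

end current

lemma setIntegral_preimage_eq_zero {ν : Measure ℝ} {g : ℝ → ℝ} (hgm : Measurable g)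
    (hg : Integrable g ν) {β : ℝ → ℂ} (hβ : Continuous β)
    (h : ∀ φ : ℂ → ℝ, Continuous φ → HasCompactSupport φ → ∫ t, φ (β t) * g t ∂ν = 0)
    {A : Set ℂ} (hA : MeasurableSet A) : ∫ t in β ⁻¹' A, g t ∂ν = 0 := by
  have hfin : ∀ f : ℝ → ℝ, Integrable f ν →
      IsFiniteMeasure ((ν.withDensity fun t => ENNReal.ofReal (f t)).map β) := fun f hf => by
    have := isFiniteMeasure_withDensity_ofReal hf.2
    infer_instance
  have h1 := hfin g hg
  have h2 := hfin _ hg.neg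
  have hint : ∀ f : ℝ → ℝ, Measurable f → ∀ φ : ℂ → ℝ, Continuous φ →
      ∫ x, φ x ∂((ν.withDensity fun t => ENNReal.ofReal (f t)).map β) =
        ∫ t, max (f t) 0 * φ (β t) ∂ν := fun f hf φ hφ => by
    rw [integral_map hβ.aemeasurable hφ.aestronglyMeasurable,
      integral_withDensity_eq_integral_toReal_smul hf.ennreal_ofReal
        (Eventually.of_forall fun _ => ENNReal.ofReal_lt_top)]
    simp only [ENNReal.toReal_ofReal', smul_eq_mul]
  have heq : (ν.withDensity fun t => ENNReal.ofReal (g t)).map β =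
      (ν.withDensity fun t => ENNReal.ofReal ((-g) t)).map β := by
    refine Measure.ext_of_integral_eq_on_compactlySupported fun φ => ?_
    obtain ⟨B, hB⟩ := φ.continuous.bounded_above_of_compact_support φ.hasCompactSupport
    have hb : ∀ f : ℝ → ℝ, Integrable f ν → Integrable (fun t => max (f t) 0 * φ (β t)) ν :=
      fun f hf => hf.pos_part.mul_bdd (c := B) (φ.continuous.comp hβ).aestronglyMeasurable
        (Eventually.of_forall fun t => hB _)
    rw [hint g hgm φ φ.continuous, hint _ hgm.neg φ φ.continuous, ← sub_eq_zero,
      ← integral_sub (hb g hg) (hb _ hg.neg)]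
    refine Eq.trans ?_ (h φ φ.continuous φ.hasCompactSupport)
    refine integral_congr_ae (Eventually.of_forall fun t => ?_)
    have : max (g t) 0 - max (-g t) 0 = g t := by
      rcases le_total 0 (g t) with h0 | h0 <;> simp [h0]
    simp only [Pi.neg_apply]
    rw [← sub_mul, this, mul_comm]
  have hA' := congrArg (fun μ => μ A) heq
  simp only [Measure.map_apply hβ.measurable hA,
    withDensity_apply _ (hβ.measurable hA)] at hA'
  rw [integral_eq_lintegral_pos_part_sub_lintegral_neg_part hg.integrableOn, hA']
  simp

lemma setIntegral_deriv_preimage_eq_zero {β : ℝ → ℂ} {C : NNReal} (hβ : LipschitzWith C β)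
    (hw : ∀ x ∉ range β, winding β x = 0) {A : Set ℂ} (hA : MeasurableSet A) :
    ∫ t in Ioc (0 : ℝ) 1 ∩ β ⁻¹' A, deriv β t = 0 := by
  have hbi : Integrable (deriv β) (volume.restrict (Ioc (0 : ℝ) 1)) :=
    Measure.integrableOn_of_bounded (M := C) (by simp)
      (measurable_deriv β).aestronglyMeasurable
      (Eventually.of_forall fun _ => norm_deriv_le_of_lipschitz hβ)
  have key : ∀ l : ℂ →L[ℝ] ℝ, l (∫ t in Ioc (0 : ℝ) 1 ∩ β ⁻¹' A, deriv β t) = 0 := fun l => by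
    rw [← l.integral_comp_comm (hbi.mono_measure (Measure.restrict_mono inter_subset_left le_rfl)),
      inter_comm, ← Measure.restrict_restrict (hβ.continuous.measurable hA)]
    refine setIntegral_preimage_eq_zero (l.continuous.measurable.comp (measurable_deriv β))
      (l.integrable_comp hbi) hβ.continuous (fun φ hφ hφc => ?_) hA
    have h := congrArg l (integral_smul_deriv_eq_zero hβ hw hφ hφc)
    obtain ⟨B, hB⟩ := hφ.bounded_above_of_compact_support hφc
    have hi : Integrable (fun t => φ (β t) • deriv β t) (volume.restrict (Ioc (0 : ℝ) 1)) :=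
      hbi.bdd_smul B (hφ.comp hβ.continuous).aestronglyMeasurable
        (Eventually.of_forall fun t => hB _)
    rw [← l.integral_comp_comm hi, map_zero] at h
    simpa only [map_smul, smul_eq_mul, Function.comp_apply] using h
  exact Complex.ext (key Complex.reCLM) (key Complex.imCLM)

lemma measurableSet_setOf_mem_pair {α : Type*} [MeasurableSpace α] (s : Finset ℕ) {A : ℕ → Set α}
    (hA : ∀ i, MeasurableSet (A i)) :
    MeasurableSet {x | ∃ i ∈ s, ∃ j ∈ s, i ≠ j ∧ x ∈ A i ∧ x ∈ A j} := by
  have : {x | ∃ i ∈ s, ∃ j ∈ s, i ≠ j ∧ x ∈ A i ∧ x ∈ A j} =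
      ⋃ i ∈ s, ⋃ j ∈ s, ⋃ _ : i ≠ j, A i ∩ A j := by
    ext x
    simp only [mem_ofPred_eq, mem_iUnion, mem_inter_iff, exists_prop]
  rw [this]
  exact s.measurableSet_biUnion fun i _ => s.measurableSet_biUnion fun j _ =>
    .iUnion fun _ => (hA i).inter (hA j)

/-- The points covered at least twice by a finite family carry at most half of the total mass. -/
lemma two_mul_measure_overlap_le {α : Type*} [MeasurableSpace α] (μ : Measure α)
    (s : Finset ℕ) {A : ℕ → Set α} (hA : ∀ i, MeasurableSet (A i)) :
    2 * μ {x | ∃ i ∈ s, ∃ j ∈ s, i ≠ j ∧ x ∈ A i ∧ x ∈ A j} ≤ ∑ i ∈ s, μ (A i) := by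
  set E := {x | ∃ i ∈ s, ∃ j ∈ s, i ≠ j ∧ x ∈ A i ∧ x ∈ A j} with hE
  calc 2 * μ E = 2 * ∫⁻ x, E.indicator 1 x ∂μ := by
        rw [lintegral_indicator_one (measurableSet_setOf_mem_pair s hA)]
    _ = ∫⁻ x, 2 * E.indicator 1 x ∂μ := (lintegral_const_mul' _ _ (by simp)).symm
    _ ≤ ∫⁻ x, ∑ i ∈ s, (A i).indicator 1 x ∂μ := by
      refine lintegral_mono fun x => ?_
      by_cases hx : x ∈ E
      · obtain ⟨i, hi, j, hj, hij, hxi, hxj⟩ := hx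
        calc (2 : ENNReal) * E.indicator 1 x ≤ 1 + 1 := by
              rw [one_add_one_eq_two]
              refine mul_le_of_le_one_right' (indicator_le_self' (by simp) x)
          _ = ∑ k ∈ {i, j}, (A k).indicator 1 x := by
            rw [Finset.sum_pair hij, indicator_of_mem hxi, indicator_of_mem hxj]
            rfl
          _ ≤ _ := Finset.sum_le_sum_of_subset (by
            rw [Finset.insert_subset_iff, Finset.singleton_subset_iff]; exact ⟨hi, hj⟩)
      · simp [indicator_of_notMem hx]
    _ = ∑ i ∈ s, μ (A i) := by
      rw [lintegral_finsetSum _ fun i _ => measurable_one.indicator (hA i)]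
      simp only [lintegral_indicator_one (hA _)]

section multiplicity

variable {β : ℝ → ℂ} {C : NNReal}

/-- The points hit by `β` in two different intervals of the uniform subdivision of `[0, 1]`. -/
def overlap (β : ℝ → ℂ) (n : ℕ) : Set ℂ :=
  {x | ∃ i ∈ Finset.range (n + 1), ∃ j ∈ Finset.range (n + 1), i ≠ j ∧
    x ∈ β '' Icc (i / (n + 1 : ℝ)) ((i + 1 : ℕ) / (n + 1 : ℝ)) ∧
    x ∈ β '' Icc (j / (n + 1 : ℝ)) ((j + 1 : ℕ) / (n + 1 : ℝ))}

lemma measurableSet_overlap (hβ : Continuous β) (n : ℕ) : MeasurableSet (overlap β n) :=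
  measurableSet_setOf_mem_pair _ fun _ => (isCompact_Icc.image hβ).measurableSet

lemma two_mul_H1_overlap_le (hβ : LipschitzWith C β) (n : ℕ) :
    2 * H1 (overlap β n) ≤ ENNReal.ofReal (curveLength β) := by
  set a : ℕ → ℝ := fun i => i / (n + 1 : ℝ) with ha
  have hmono : Monotone a := fun i j hij => by
    simp only [ha]; gcongr
  have ha0 : a 0 = 0 := by simp [ha]
  have ha1 : a (n + 1) = 1 := by
    simp only [ha]; push_cast; exact div_self (by positivity)
  calc 2 * H1 (overlap β n)
      ≤ ∑ i ∈ Finset.range (n + 1), H1 (β '' Icc (a i) (a (i + 1))) :=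
        two_mul_measure_overlap_le H1 _ fun i =>
          (isCompact_Icc.image hβ.continuous).measurableSet
    _ ≤ ∑ i ∈ Finset.range (n + 1),
        ∫⁻ t in Ioc (a i) (a (i + 1)), ENNReal.ofReal ‖deriv β t‖ :=
        Finset.sum_le_sum fun i _ => H1_image_Icc_le hβ
    _ = ∫⁻ t in ⋃ i ∈ Finset.range (n + 1), Ioc (a i) (a (i + 1)),
        ENNReal.ofReal ‖deriv β t‖ :=
        (lintegral_biUnion_finset
          (hmono.pairwise_disjoint_on_Ioc_succ.set_pairwise _)
          (fun i _ => measurableSet_Ioc) _).symm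
    _ ≤ ∫⁻ t in Ioc (0 : ℝ) 1, ENNReal.ofReal ‖deriv β t‖ := by
      refine lintegral_mono_set (iUnion₂_subset fun i hi => Ioc_subset_Ioc ?_ ?_)
      · rw [← ha0]; exact hmono (Nat.zero_le i)
      · rw [← ha1]; exact hmono (Finset.mem_range.1 hi)
    _ = ENNReal.ofReal (curveLength β) := by
      rw [curveLength, intervalIntegral.integral_of_le zero_le_one,
        ofReal_integral_eq_lintegral_ofReal (intervalIntegrable_norm_deriv hβ 0 1).1
          (Eventually.of_forall fun _ => norm_nonneg _)]

lemma mem_overlap {s t : ℝ} (hs : s ∈ Ioc (0 : ℝ) 1) (ht : t ∈ Ioc (0 : ℝ) 1)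
    (h : β s = β t) {n : ℕ} (hn : 1 / (n + 1 : ℝ) < |s - t|) : β s ∈ overlap β n := by
  have key : ∀ r ∈ Ioc (0 : ℝ) 1, ∃ i ∈ Finset.range (n + 1),
      r ∈ Icc (i / (n + 1 : ℝ)) ((i + 1 : ℕ) / (n + 1 : ℝ)) := by
    intro r hr
    have hn0 : (0 : ℝ) < n + 1 := by positivity
    have hpos : 0 < r * (n + 1) := mul_pos hr.1 hn0
    have hc : 0 < ⌈r * (n + 1)⌉₊ := Nat.ceil_pos.2 hpos
    obtain ⟨i, hi⟩ := Nat.exists_eq_succ_of_ne_zero hc.ne'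
    have h1 := Nat.ceil_lt_add_one hpos.le
    have h2 := Nat.le_ceil (r * (n + 1))
    have h3 : ⌈r * (n + 1)⌉₊ ≤ n + 1 := by
      refine Nat.ceil_le.2 ?_
      push_cast
      nlinarith [hr.2]
    rw [hi] at h1 h2 h3
    refine ⟨i, Finset.mem_range.2 h3, (div_le_iff₀ hn0).2 ?_, (le_div_iff₀ hn0).2 h2⟩
    push_cast at h1
    linarith
  obtain ⟨i, hi, hsi⟩ := key s hs
  obtain ⟨j, hj, htj⟩ := key t ht
  refine ⟨i, hi, j, hj, ?_, mem_image_of_mem β hsi, h ▸ mem_image_of_mem β htj⟩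
  rintro rfl
  refine absurd hn (not_lt.2 ?_)
  have := abs_sub_le_of_le_of_le hsi.1 hsi.2 htj.1 htj.2
  refine this.trans_eq ?_
  push_cast
  ring

/-- A Lipschitz closed curve with vanishing winding number covers almost every point of its image
at least twice. -/
lemma two_mul_H1_range_le (hper : Function.Periodic β 1) (hβ : LipschitzWith C β)
    (hw : ∀ x ∉ range β, winding β x = 0) :
    2 * H1 (range β) ≤ ENNReal.ofReal (curveLength β) := by
  set D : ℕ → Set ℂ := fun m => ⋂ n ≥ m, overlap β n with hD
  have hDm : ∀ m, MeasurableSet (D m) := fun m =>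
    .iInter fun n => .iInter fun _ => measurableSet_overlap hβ.continuous n
  have hDmono : Monotone D := fun m k hmk =>
    biInter_subset_biInter_left fun n (hn : k ≤ n) => hmk.trans hn
  set E : Set ℂ := ⋃ m, D m with hE
  have hEm : MeasurableSet E := .iUnion hDm
  have hEle : 2 * H1 E ≤ ENNReal.ofReal (curveLength β) := by
    rw [hE, hDmono.measure_iUnion, ENNReal.mul_iSup]
    refine iSup_le fun m => le_trans ?_ (two_mul_H1_overlap_le hβ m)
    gcongr
    exact biInter_subset_of_mem (le_refl m)
  set F : Set ℝ := Ioc 0 1 \ β ⁻¹' E with hF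
  have hFm : MeasurableSet F := measurableSet_Ioc.diff (hβ.continuous.measurable hEm)
  have hinj : ∀ s ∈ F, ∀ t ∈ Ioc (0 : ℝ) 1, β s = β t → s = t := by
    intro s hs t ht hst
    by_contra hne
    obtain ⟨m, hm⟩ := exists_nat_one_div_lt (abs_pos.2 (sub_ne_zero.2 hne))
    refine hs.2 (mem_iUnion.2 ⟨m, mem_iInter₂.2 fun n hn => mem_overlap hs.1 ht hst ?_⟩)
    exact (Nat.one_div_le_one_div hn).trans_lt hm
  have hderiv : ∀ᵐ t, t ∈ F → deriv β t = 0 := by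
    have hbi : Integrable (deriv β) (volume.restrict F) :=
      Measure.integrableOn_of_bounded (M := C) (ne_top_of_le_ne_top (by simp) (measure_mono sdiff_subset))
        (measurable_deriv β).aestronglyMeasurable
        (Eventually.of_forall fun _ => norm_deriv_le_of_lipschitz hβ)
    refine (ae_restrict_iff' hFm).1 (hbi.ae_eq_zero_of_forall_setIntegral_eq_zero fun s hs _ => ?_)
    have hA : MeasurableSet (β '' (s ∩ F)) :=
      (hs.inter hFm).image_of_continuousOn_injOn hβ.continuous.continuousOn
        fun u hu v hv huv => hinj u hu.2 v hv.2.1 huv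
    rw [Measure.restrict_restrict hs, ← setIntegral_deriv_preimage_eq_zero hβ hw hA]
    congr 2
    refine subset_antisymm (fun t ht => ⟨ht.2.1, mem_image_of_mem β ht⟩) ?_
    rintro t ⟨ht, u, hu, hut⟩
    rwa [← hinj u hu.2 t ht hut]
  have hF0 : H1 (β '' F) = 0 := H1_image_eq_zero_of_deriv hβ hderiv
  have hsub : range β ⊆ β '' F ∪ E := by
    rintro _ ⟨t, rfl⟩
    obtain ⟨s, hs, hst⟩ := hper.exists_mem_Ioc one_pos t 0
    rw [zero_add] at hs
    rw [hst]
    by_cases h : β s ∈ E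
    · exact Or.inr h
    · exact Or.inl ⟨s, ⟨hs, h⟩, rfl⟩
  refine le_trans ?_ hEle
  gcongr 2 * ?_
  refine (measure_mono (μ := H1) hsub).trans ((measure_union_le (μ := H1) _ _).trans ?_)
  rw [hF0, zero_add]

end multiplicity

lemma InClass.two_mul_H1_range_le {S : Set ℂ} {β : ℝ → ℂ} (hβ : InClass S β) :
    2 * H1 (range β) ≤ ENNReal.ofReal (curveLength β) := by
  obtain ⟨hper, ⟨C, hC⟩, -, hw⟩ := hβ
  exact _root_.two_mul_H1_range_le hper hC hw

lemma InClass.isCompact_range {S : Set ℂ} {β : ℝ → ℂ} (hβ : InClass S β) :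
    IsCompact (range β) := by
  obtain ⟨hper, ⟨C, hC⟩, -⟩ := hβ
  have h := hper.image_Icc one_pos 0
  rw [← h]
  exact isCompact_Icc.image hC.continuous

lemma InClass.isConnected_range {S : Set ℂ} {β : ℝ → ℂ} (hβ : InClass S β) :
    IsConnected (range β) := by
  obtain ⟨-, ⟨C, hC⟩, -⟩ := hβ
  exact _root_.isConnected_range hC.continuous

lemma curveLength_nonneg (β : ℝ → ℂ) : 0 ≤ curveLength β :=
  intervalIntegral.integral_nonneg zero_le_one fun _ _ => norm_nonneg _

/-- equivalence of the planar Plateau (Steiner) problem and length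
minimization in the curve class. If K is an H¹-minimizing compact connected set
containing the finite set S, and γ_K is a Lipschitz closed curve with image K, zero
winding number off K, and length 2H¹(K), then γ_K minimizes length in the class.
Conversely, any length minimizer γ in the class has compact connected image containing S
which minimizes H¹ among compact connected sets containing S. -/
theorem stmt_19 (S : Set ℂ) (hS : S.Finite) :
    (∀ (K : Set ℂ) (γK : ℝ → ℂ), IsCompact K → IsConnected K → S ⊆ K → H1 K ≠ ⊤ →
      (∀ K' : Set ℂ, IsCompact K' → IsConnected K' → S ⊆ K' → H1 K ≤ H1 K') →
      InClass S γK → Set.range γK = K →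
      ENNReal.ofReal (curveLength γK) = 2 * H1 K →
      ∀ β : ℝ → ℂ, InClass S β → curveLength γK ≤ curveLength β) ∧
    (∀ γ : ℝ → ℂ, InClass S γ → (∀ β : ℝ → ℂ, InClass S β → curveLength γ ≤ curveLength β) →
      IsCompact (Set.range γ) ∧ IsConnected (Set.range γ) ∧ S ⊆ Set.range γ ∧
        ∀ K' : Set ℂ, IsCompact K' → IsConnected K' → S ⊆ K' →
          H1 (Set.range γ) ≤ H1 K') := by
  refine ⟨fun K γK _ _ _ _ hmin _ _ hlen β hβ => ?_, fun γ hγ hmin =>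
    ⟨hγ.isCompact_range, hγ.isConnected_range, hγ.2.2.1, fun K' hK'c hK' hSK' => ?_⟩⟩
  · rw [← ENNReal.ofReal_le_ofReal_iff (curveLength_nonneg β), hlen]
    refine le_trans ?_ hβ.two_mul_H1_range_le
    gcongr 2 * ?_
    exact hmin _ hβ.isCompact_range hβ.isConnected_range hβ.2.2.1
  · rcases eq_or_ne (H1 K') ⊤ with h | hfin
    · rw [h]
      exact le_top
    have h2 : 2 * H1 (range γ) ≤ 2 * H1 K' := by
      refine ENNReal.le_of_forall_pos_le_add fun ε hε _ => ?_
      obtain ⟨β, hβ, hlen⟩ := exists_inClass_curveLength_le hS hK'c hK' hfin hSK'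
        (NNReal.coe_pos.2 hε)
      rw [ENNReal.ofReal_coe_nnreal] at hlen
      exact hγ.two_mul_H1_range_le.trans
        ((ENNReal.ofReal_le_ofReal (hmin β hβ)).trans hlen)
    exact (ENNReal.mul_le_mul_iff_right two_ne_zero ENNReal.ofNat_ne_top).1 h2
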